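/- arXiv:1406.6227 — 2 statements merged into one kernel-verified Lean document; each statement's English description precedes it below -/
import Mathlib

section
/- Let g : ℝ^q → ℝ be integrable and square integrable, and let K : ℝ^q → ℝ be an even integrable function. Then for every h > 0, h^{−q} ∫∫ g(x) g(y) K((x−y)/h) dx dy = ∫ |𝓕g(u)|² 𝓕K(hu) du, and consequently lim_{h→0⁺} h^{−q} ∫∫ g(x) g(y) K((x−y)/h) dx dy = (∫ K(x) dx)(∫ g(x)² dx). -/
/- STATEMENT 10: Plancherel-type identity and limit:
`h^{−q} ∫∫ g(x)g(y)K((x−y)/h) dx dy = ∫ |𝓕g(u)|² 𝓕K(hu) du` for every `h > 0`, and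
the left side tends to `(∫K)(∫g²)` as `h → 0⁺`. -/

open MeasureTheory Filter
open scoped ENNReal NNReal Topology

noncomputable section

/-- Fourier transform (convention `∫ e^{-2πi u·x} f(x) dx`) of a real function on `ℝ^q`. -/
noncomputable def FTq {q : ℕ} (f : EuclideanSpace ℝ (Fin q) → ℝ) :
    EuclideanSpace ℝ (Fin q) → ℂ :=
  FourierTransform.fourier (fun x => (f x : ℂ))

open FourierTransform RealInnerProductSpace

section FourierL1L2

variable {V : Type*} [NormedAddCommGroup V] [InnerProductSpace ℝ V] [FiniteDimensional ℝ V]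
  [MeasurableSpace V] [BorelSpace V]

theorem continuous_fourier_of_integrable {f : V → ℂ} (hf : Integrable f) : Continuous (𝓕 f) :=
  VectorFourier.fourierIntegral_continuous Real.continuous_fourierChar
    (by exact continuous_inner) hf

theorem norm_fourier_le_integral_norm (f : V → ℂ) (u : V) : ‖𝓕 f u‖ ≤ ∫ x, ‖f x‖ :=
  VectorFourier.norm_fourierIntegral_le_integral_norm _ _ _ _ _

/-- The Fourier transform is self-adjoint for the bilinear pairing. -/
theorem integral_fourier_mul_eq {f k : V → ℂ} (hf : Integrable f) (hk : Integrable k) :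
    ∫ u, 𝓕 f u * k u = ∫ x, f x * 𝓕 k x := by
  have := VectorFourier.integral_fourierIntegral_smul_eq_flip (μ := (volume : Measure V))
    (ν := (volume : Measure V)) (L := innerₗ V) Real.continuous_fourierChar
    (by exact continuous_inner) hf hk
  rw [flip_innerₗ] at this
  exact this

/-- On `L¹ ∩ L²` the `L²` Fourier transform is given by the Fourier integral. -/
theorem fourier_toLp_ae_eq {f : V → ℂ} (hf : Integrable f) (hf2 : MemLp f 2) :
    (𝓕 (hf2.toLp f) : Lp ℂ 2 (volume : Measure V)) =ᵐ[volume] 𝓕 f := by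
  refine ae_eq_of_integral_contDiff_smul_eq ((Lp.memLp _).locallyIntegrable (by norm_num))
    (continuous_fourier_of_integrable hf).locallyIntegrable fun φ hφ hφc => ?_
  have hc : HasCompactSupport (Complex.ofRealCLM ∘ φ) := hφc.comp_left rfl
  have hs : ContDiff ℝ ((⊤ : ℕ∞) : WithTop ℕ∞) (Complex.ofRealCLM ∘ φ) :=
    Complex.ofRealCLM.contDiff.comp hφ
  have key := congrArg (fun T => T (hc.toSchwartzMap hs))
    (Lp.fourier_toTemperedDistribution_eq (hf2.toLp f))
  simp only [TemperedDistribution.fourier_apply, Lp.toTemperedDistribution_apply] at key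
  have hflip := integral_fourier_mul_eq hf (hc.toSchwartzMap hs).integrable
  calc ∫ x, φ x • (𝓕 (hf2.toLp f) : Lp ℂ 2 (volume : Measure V)) x
      = ∫ x, (𝓕 (hc.toSchwartzMap hs)) x • (hf2.toLp f) x := by
        rw [key]; rfl
    _ = ∫ x, f x * 𝓕 (⇑(hc.toSchwartzMap hs)) x := by
        refine integral_congr_ae ?_
        filter_upwards [hf2.coeFn_toLp] with x hx
        rw [hx, SchwartzMap.fourier_coe, smul_eq_mul, mul_comm]
    _ = ∫ x, φ x • 𝓕 f x := by
        rw [← hflip]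
        refine integral_congr_ae (Eventually.of_forall fun x => ?_)
        change 𝓕 f x * (φ x : ℂ) = φ x • 𝓕 f x
        rw [Complex.real_smul, mul_comm]

theorem memLp_two_fourier {f : V → ℂ} (hf : Integrable f) (hf2 : MemLp f 2) :
    MemLp (𝓕 f) 2 :=
  (memLp_congr_ae (fourier_toLp_ae_eq hf hf2)).1 (Lp.memLp _)

/-- Plancherel's theorem on `L¹ ∩ L²`, in polarized form. -/
theorem integral_inner_fourier {f k : V → ℂ} (hf : Integrable f) (hf2 : MemLp f 2)
    (hk : Integrable k) (hk2 : MemLp k 2) :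
    ∫ u, inner ℂ (𝓕 f u) (𝓕 k u) = ∫ x, inner ℂ (f x) (k x) := by
  have h := Lp.inner_fourier_eq (hf2.toLp f) (hk2.toLp k)
  rw [L2.inner_def, L2.inner_def] at h
  calc _ = _ := integral_congr_ae ?_
    _ = _ := h
    _ = _ := integral_congr_ae ?_
  · filter_upwards [fourier_toLp_ae_eq hf hf2, fourier_toLp_ae_eq hk hk2] with x h1 h2
    rw [h1, h2]
  · filter_upwards [hf2.coeFn_toLp, hk2.coeFn_toLp] with x h1 h2
    rw [h1, h2]

theorem fourier_comp_sub_right (f : V → ℂ) (z u : V) :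
    𝓕 (fun x => f (x - z)) u = (Real.fourierChar (-⟪z, u⟫) : ℂ) * 𝓕 f u := by
  have := congrFun (VectorFourier.fourierIntegral_comp_add_right Real.fourierChar
    (volume : Measure V) (innerₗ V) f (-z)) u
  simp only [map_neg, LinearMap.neg_apply, innerₗ_apply_apply, Circle.smul_def,
    smul_eq_mul] at this
  simp only [sub_eq_add_neg]
  exact this

theorem fourier_comp_inv_smul (f : V → ℂ) {h : ℝ} (hh : 0 < h) (u : V) :
    𝓕 (fun x => f (h⁻¹ • x)) u = (h ^ Module.finrank ℝ V : ℝ) * 𝓕 f (h • u) := by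
  rw [Real.fourier_eq, Real.fourier_eq, ← Complex.real_smul,
    ← Measure.integral_comp_inv_smul_of_nonneg volume _ hh.le]
  refine integral_congr_ae (Eventually.of_forall fun x => ?_)
  simp only [real_inner_smul_left, real_inner_smul_right]
  rw [mul_inv_cancel_left₀ hh.ne']

section RealValued

variable {g K : V → ℝ}

theorem integrable_norm_fourier_sq (hg : Integrable g) (hg2 : MemLp g 2) :
    Integrable (fun u => ‖𝓕 (fun x => (g x : ℂ)) u‖ ^ 2) :=
  (memLp_two_fourier hg.ofReal hg2.ofReal).integrable_norm_pow (by norm_num)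

/-- The autocorrelation of `g` is the Fourier transform of its power spectrum. -/
theorem integral_mul_comp_sub_eq_fourier (hg : Integrable g) (hg2 : MemLp g 2) (z : V) :
    ((∫ x, g x * g (x - z) : ℝ) : ℂ) =
      𝓕 (fun u => ((‖𝓕 (fun x => (g x : ℂ)) u‖ ^ 2 : ℝ) : ℂ)) z := by
  have hz := measurePreserving_sub_right (volume : Measure V) z
  have h := integral_inner_fourier (k := fun x => (g (x - z) : ℂ)) hg.ofReal hg2.ofReal
    (hg.comp_sub_right z).ofReal (hg2.comp_measurePreserving hz).ofReal
  rw [← integral_complex_ofReal, Real.fourier_eq]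
  calc _ = _ := integral_congr_ae (Eventually.of_forall fun x => ?_)
    _ = _ := h.symm
    _ = _ := integral_congr_ae (Eventually.of_forall fun u => ?_)
  · simp [mul_comm]
  · simp only [fourier_comp_sub_right (fun x => (g x : ℂ)) z u, Circle.smul_def, smul_eq_mul,
      RCLike.inner_apply, real_inner_comm u z]
    rw [mul_assoc]
    exact congrArg _ ((Complex.mul_conj _).trans (by rw [Complex.normSq_eq_norm_sq]))

theorem integrable_mul_comp_sub_mul (hg2 : MemLp g 2) (hK : Integrable K) :
    Integrable (fun p : V × V => g p.1 * g (p.1 - p.2) * K p.2) (volume.prod volume) := by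
  have hsq : Integrable (fun x => g x ^ 2) := hg2.integrable_sq
  have hmeas : AEStronglyMeasurable (fun p : V × V => g p.1 * g (p.1 - p.2) * K p.2)
      (volume.prod volume) :=
    (hg2.1.comp_fst.mul (hg2.1.comp_quasiMeasurePreserving
      (quasiMeasurePreserving_sub volume volume))).mul hK.1.comp_snd
  have hshift (z : V) : MemLp (fun x => g (x - z)) 2 :=
    hg2.comp_measurePreserving (measurePreserving_sub_right (volume : Measure V) z)
  have hprod (z : V) : Integrable (fun x => g x * g (x - z)) := hg2.integrable_mul (hshift z)
  refine (integrable_prod_iff' hmeas).2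
    ⟨Eventually.of_forall fun z => (hprod z).mul_const (K z), ?_⟩
  refine (hK.norm.mul_const (∫ x, g x ^ 2)).mono' hmeas.norm.prod_swap.integral_prod_right'
    (Eventually.of_forall fun z => ?_)
  have hbound : ∫ x, ‖g x * g (x - z)‖ ≤ ∫ x, g x ^ 2 := by
    calc ∫ x, ‖g x * g (x - z)‖ ≤ ∫ x, (g x ^ 2 + g (x - z) ^ 2) / 2 := by
          refine integral_mono (hprod z).norm ((hsq.add (hshift z).integrable_sq).div_const 2)
            fun x => ?_
          simp only [norm_mul, Real.norm_eq_abs]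
          nlinarith [sq_nonneg (|g x| - |g (x - z)|), sq_abs (g x), sq_abs (g (x - z))]
      _ = ∫ x, g x ^ 2 := by
          rw [integral_div, integral_add hsq (hshift z).integrable_sq,
            integral_sub_right_eq_self (fun x => g x ^ 2) z]
          ring
  simp only [norm_mul _ (K _), integral_mul_const]
  rw [Real.norm_of_nonneg (by positivity), mul_comm]
  exact mul_le_mul_of_nonneg_left hbound (norm_nonneg _)

theorem integral_integral_mul_mul_comp_sub (hg2 : MemLp g 2) (hK : Integrable K) :
    ∫ x, ∫ y, g x * g y * K (x - y) = ∫ z, K z * ∫ x, g x * g (x - z) := by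
  calc ∫ x, ∫ y, g x * g y * K (x - y) = ∫ x, ∫ z, g x * g (x - z) * K z := by
        refine integral_congr_ae (Eventually.of_forall fun x => ?_)
        simpa using (integral_sub_left_eq_self (fun y => g x * g y * K (x - y)) volume x).symm
    _ = ∫ z, ∫ x, g x * g (x - z) * K z :=
        integral_integral_swap (integrable_mul_comp_sub_mul hg2 hK)
    _ = ∫ z, K z * ∫ x, g x * g (x - z) := by
        simp only [integral_mul_const, mul_comm (K _)]

theorem integral_integral_mul_mul_comp_sub_eq_fourier (hg : Integrable g) (hg2 : MemLp g 2)
    (hK : Integrable K) :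
    ∫ x, ∫ y, g x * g y * K (x - y) =
      ∫ u, ‖𝓕 (fun x => (g x : ℂ)) u‖ ^ 2 * (𝓕 (fun x => (K x : ℂ)) u).re := by
  have hP := integrable_norm_fourier_sq hg hg2
  have hflip := integral_fourier_mul_eq (f := fun x => (K x : ℂ))
    (k := fun u => ((‖𝓕 (fun x => (g x : ℂ)) u‖ ^ 2 : ℝ) : ℂ)) hK.ofReal hP.ofReal
  have hint : Integrable (fun u => 𝓕 (fun x => (K x : ℂ)) u *
      ((‖𝓕 (fun x => (g x : ℂ)) u‖ ^ 2 : ℝ) : ℂ)) :=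
    hP.ofReal.bdd_mul (continuous_fourier_of_integrable hK.ofReal).aestronglyMeasurable
      (Eventually.of_forall (norm_fourier_le_integral_norm _))
  rw [integral_integral_mul_mul_comp_sub hg2 hK]
  have hcorr : ∫ x, (K x : ℂ) * 𝓕 (fun u => ((‖𝓕 (fun x => (g x : ℂ)) u‖ ^ 2 : ℝ) : ℂ)) x =
      ((∫ z, K z * ∫ x, g x * g (x - z) : ℝ) : ℂ) := by
    rw [← integral_complex_ofReal]
    simp only [Complex.ofReal_mul, integral_mul_comp_sub_eq_fourier hg hg2]
  rw [← Complex.ofReal_re (∫ z, _), ← hcorr, ← hflip]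
  refine (integral_re hint).symm.trans (integral_congr_ae (Eventually.of_forall fun u => ?_))
  change (_ * _ : ℂ).re = _
  rw [Complex.re_mul_ofReal, mul_comm]

theorem integral_norm_fourier_sq (hg : Integrable g) (hg2 : MemLp g 2) :
    ∫ u, ‖𝓕 (fun x => (g x : ℂ)) u‖ ^ 2 = ∫ x, g x ^ 2 := by
  have h := integral_mul_comp_sub_eq_fourier hg hg2 0
  rw [Real.fourier_eq] at h
  simp only [sub_zero, inner_zero_right, neg_zero, AddChar.map_zero_eq_one,
    one_smul, integral_complex_ofReal, Complex.ofReal_inj] at h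
  rw [← h]
  simp only [sq]

theorem tendsto_integral_norm_fourier_sq_mul (hg : Integrable g) (hg2 : MemLp g 2)
    (hK : Integrable K) :
    Tendsto (fun h : ℝ => ∫ u, ‖𝓕 (fun x => (g x : ℂ)) u‖ ^ 2 *
      (𝓕 (fun x => (K x : ℂ)) (h • u)).re) (𝓝 0) (𝓝 ((∫ x, K x) * ∫ x, g x ^ 2)) := by
  have hP := integrable_norm_fourier_sq hg hg2
  have hc := continuous_fourier_of_integrable (hK.ofReal (𝕜 := ℂ))
  have hzero : (𝓕 (fun x => (K x : ℂ)) 0).re = ∫ x, K x := by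
    simp [Real.fourier_eq, integral_complex_ofReal]
  rw [mul_comm, ← integral_norm_fourier_sq hg hg2, ← hzero, ← integral_mul_const]
  refine tendsto_integral_filter_of_dominated_convergence
    (fun u => ‖𝓕 (fun x => (g x : ℂ)) u‖ ^ 2 * ∫ x, ‖(K x : ℂ)‖)
    (Eventually.of_forall fun h => hP.1.mul (Complex.continuous_re.comp
      (hc.comp (continuous_const_smul h))).aestronglyMeasurable)
    (Eventually.of_forall fun h => Eventually.of_forall fun u => ?_) (hP.mul_const _)
    (Eventually.of_forall fun u => ?_)
  · rw [norm_mul, Real.norm_of_nonneg (by positivity)]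
    gcongr
    exact (Complex.abs_re_le_norm _).trans (norm_fourier_le_integral_norm _ _)
  · have : Continuous fun h : ℝ => ‖𝓕 (fun x => (g x : ℂ)) u‖ ^ 2 *
        (𝓕 (fun x => (K x : ℂ)) (h • u)).re :=
      continuous_const.mul (Complex.continuous_re.comp
        (hc.comp (continuous_id.smul continuous_const)))
    simpa using this.tendsto 0

end RealValued

end FourierL1L2

theorem stmt10
    {q : ℕ} (g K : EuclideanSpace ℝ (Fin q) → ℝ)
    (hgint : Integrable g) (hg2int : Integrable (fun x => g x ^ 2))
    (hKint : Integrable K) (hKeven : ∀ x, K (-x) = K x) :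
    (∀ h : ℝ, 0 < h →
      (h ^ q)⁻¹ * ∫ x, ∫ y, g x * g y * K (h⁻¹ • (x - y)) =
        ∫ u, ‖FTq g u‖ ^ 2 * (FTq K (h • u)).re) ∧
    Tendsto (fun h : ℝ => (h ^ q)⁻¹ * ∫ x, ∫ y, g x * g y * K (h⁻¹ • (x - y)))
      (nhdsWithin 0 (Set.Ioi 0)) (𝓝 ((∫ x, K x) * ∫ x, g x ^ 2)) := by
  have hg2 : MemLp g 2 := (memLp_two_iff_integrable_sq hgint.1).2 hg2int
  have heq : ∀ h : ℝ, 0 < h →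
      (h ^ q)⁻¹ * ∫ x, ∫ y, g x * g y * K (h⁻¹ • (x - y)) =
        ∫ u, ‖FTq g u‖ ^ 2 * (FTq K (h • u)).re := by
    intro h hh
    rw [integral_integral_mul_mul_comp_sub_eq_fourier (K := fun z => K (h⁻¹ • z)) hgint hg2
      (hKint.comp_smul (inv_ne_zero hh.ne')), ← integral_const_mul]
    refine integral_congr_ae (Eventually.of_forall fun u => ?_)
    simp only [fourier_comp_inv_smul (fun x => (K x : ℂ)) hh u, Complex.re_ofReal_mul,
      finrank_euclideanSpace_fin, FTq]
    field_simp
  refine ⟨heq, ((tendsto_integral_norm_fourier_sq_mul hgint hg2 hKint).mono_left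
    nhdsWithin_le_nhds).congr' ?_⟩
  filter_upwards [self_mem_nhdsWithin] with h hh
  exact (heq h hh).symm

end
end

section
/- Let Z₁,…,Zₙ be i.i.d. real random variables with a bounded density f_Z, let K₁ : ℝ → [0,M] be a bounded, measurable and integrable function, let (bₙ) be any real sequence, and let hₙ > 0 satisfy n hₙ/log n → ∞. Define m_n(z) = E[K₁((z − Z₁ + 2bₙ)/hₙ)]. Then for every t > 0, P( max_{1≤i≤n} | n^{−1} Σ_{j=1}^n K₁((Zᵢ − Zⱼ + 2bₙ)/hₙ) − m_n(Zᵢ) | > t hₙ ) → 0 as n → ∞. -/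
open MeasureTheory ProbabilityTheory Filter
open scoped ENNReal NNReal Topology

noncomputable section

/-- A variable with values in `[0, M]` has variance at most `M` times its mean; this is the
corresponding Bernstein bound on the moment generating function. -/
theorem mgf_le_exp_of_mem_Icc {Ω : Type*} [MeasurableSpace Ω] {μ : Measure Ω}
    [IsProbabilityMeasure μ] {Y : Ω → ℝ} {M s : ℝ} (hY : Measurable Y)
    (hYM : ∀ ω, Y ω ∈ Set.Icc 0 M) (hs : |s| * M ≤ 1) :
    mgf Y μ s ≤ Real.exp (s * ∫ ω, Y ω ∂μ + s ^ 2 * M * ∫ ω, Y ω ∂μ) := by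
  have hYint : Integrable Y μ := Integrable.of_mem_Icc 0 M hY.aemeasurable (.of_forall hYM)
  have key : mgf Y μ s ≤ ∫ ω, (1 + (s + s ^ 2 * M) * Y ω) ∂μ := by
    refine integral_mono
      (integrable_exp_mul_of_mem_Icc hY.aemeasurable (.of_forall hYM))
      ((integrable_const _).add (hYint.const_mul _)) fun ω => ?_
    obtain ⟨h0, h1⟩ := hYM ω
    have habs : |s * Y ω| ≤ 1 := by
      rw [abs_mul, abs_of_nonneg h0]
      exact (mul_le_mul_of_nonneg_left h1 (abs_nonneg s)).trans hs
    have h2 := (abs_le.mp (Real.abs_exp_sub_one_sub_id_le habs)).2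
    have h3 : (s * Y ω) ^ 2 ≤ s ^ 2 * M * Y ω := by
      have := mul_le_mul_of_nonneg_left (mul_le_mul_of_nonneg_right h1 h0) (sq_nonneg s)
      linarith
    simp only
    linarith
  rw [integral_add (integrable_const _) (hYint.const_mul _), integral_const_mul] at key
  simp only [integral_const, probReal_univ, smul_eq_mul, one_mul] at key
  calc mgf Y μ s ≤ (s + s ^ 2 * M) * ∫ ω, Y ω ∂μ + 1 := by linarith
    _ ≤ _ := by
      convert Real.add_one_le_exp ((s + s ^ 2 * M) * ∫ ω, Y ω ∂μ) using 2
      ring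

/-- Two-sided Bernstein-type tail bound for sums of independent variables with values in `[0, M]`
and common mean `m`. -/
theorem measureReal_abs_sum_sub_ge_le {Ω ι : Type*} [MeasurableSpace Ω] {μ : Measure Ω}
    [IsProbabilityMeasure μ] {Y : ι → Ω → ℝ} {M m s : ℝ} (hY : ∀ i, Measurable (Y i))
    (hindep : iIndepFun Y μ) (hYM : ∀ i ω, Y i ω ∈ Set.Icc 0 M)
    (hmean : ∀ i, ∫ ω, Y i ω ∂μ = m) (hs0 : 0 ≤ s) (hs : s * M ≤ 1) (S : Finset ι) (a : ℝ) :
    μ.real {ω | a ≤ |∑ i ∈ S, (Y i ω - m)|} ≤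
      2 * Real.exp (S.card * (s ^ 2 * M * m) - s * a) := by
  have hmgf : ∀ u : ℝ, |u| * M ≤ 1 →
      mgf (∑ i ∈ S, Y i) μ u ≤ Real.exp (S.card * (u * m + u ^ 2 * M * m)) := by
    intro u hu
    rw [hindep.mgf_sum hY, Real.exp_nat_mul, ← Finset.prod_const]
    refine Finset.prod_le_prod (fun i _ => mgf_nonneg) fun i _ => ?_
    simpa only [hmean i] using mgf_le_exp_of_mem_Icc (μ := μ) (hY i) (hYM i) hu
  have hint : ∀ u : ℝ, Integrable (fun ω => Real.exp (u * (∑ i ∈ S, Y i) ω)) μ := by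
    intro u
    refine integrable_exp_mul_of_mem_Icc (a := 0) (b := S.card * M)
      (by fun_prop) (.of_forall fun ω => ?_)
    rw [Finset.sum_apply]
    refine ⟨Finset.sum_nonneg fun i _ => (hYM i ω).1, ?_⟩
    simpa using Finset.sum_le_card_nsmul S (fun i => Y i ω) M fun i _ => (hYM i ω).2
  have hup : μ.real {ω | S.card * m + a ≤ (∑ i ∈ S, Y i) ω} ≤
      Real.exp (S.card * (s ^ 2 * M * m) - s * a) := by
    refine (measure_ge_le_exp_mul_mgf _ hs0 (hint s)).trans ?_
    refine (mul_le_mul_of_nonneg_left (hmgf s (by rwa [abs_of_nonneg hs0]))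
      (Real.exp_pos _).le).trans_eq ?_
    rw [← Real.exp_add]
    ring_nf
  have hlow : μ.real {ω | (∑ i ∈ S, Y i) ω ≤ S.card * m - a} ≤
      Real.exp (S.card * (s ^ 2 * M * m) - s * a) := by
    refine (measure_le_le_exp_mul_mgf _ (neg_nonpos.mpr hs0) (hint (-s))).trans ?_
    refine (mul_le_mul_of_nonneg_left (hmgf (-s) (by rwa [abs_neg, abs_of_nonneg hs0]))
      (Real.exp_pos _).le).trans_eq ?_
    rw [← Real.exp_add]
    ring_nf
  have hsub : {ω | a ≤ |∑ i ∈ S, (Y i ω - m)|} ⊆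
      {ω | S.card * m + a ≤ (∑ i ∈ S, Y i) ω} ∪ {ω | (∑ i ∈ S, Y i) ω ≤ S.card * m - a} := by
    intro ω hω
    simp only [Set.mem_ofPred_eq, Finset.sum_sub_distrib, Finset.sum_const, nsmul_eq_mul,
      le_abs] at hω
    simp only [Set.mem_union, Set.mem_ofPred_eq, Finset.sum_apply]
    rcases hω with h | h
    · left; linarith
    · right; linarith
  calc _ ≤ _ := measureReal_mono hsub
    _ ≤ _ := measureReal_union_le _ _
    _ ≤ _ := by linarith

/-- If `X` and `W` are independent, an event about `(X, W)` is at most as likely as the least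
favourable of the events obtained by freezing the value of `X`. -/
theorem IndepFun.measureReal_prodMk_mem_le {Ω α β : Type*} [MeasurableSpace Ω]
    [MeasurableSpace α] [MeasurableSpace β] {μ : Measure Ω} [IsProbabilityMeasure μ]
    {X : Ω → α} {W : Ω → β} (hXW : IndepFun X W μ) (hX : Measurable X) (hW : Measurable W)
    {A : Set (α × β)} (hA : MeasurableSet A) {ε : ℝ}
    (hε : ∀ x, μ.real {ω | (x, W ω) ∈ A} ≤ ε) :
    μ.real {ω | (X ω, W ω) ∈ A} ≤ ε := by
  have : Nonempty Ω := nonempty_of_isProbabilityMeasure μ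
  have hε0 : 0 ≤ ε := measureReal_nonneg.trans (hε (X (Classical.arbitrary Ω)))
  have := Measure.isProbabilityMeasure_map (μ := μ) hX.aemeasurable
  refine ENNReal.toReal_le_of_le_ofReal hε0 ?_
  calc μ {ω | (X ω, W ω) ∈ A} = μ.map (fun ω => (X ω, W ω)) A :=
        (Measure.map_apply (hX.prodMk hW) hA).symm
    _ = ∫⁻ x, μ.map W (Prod.mk x ⁻¹' A) ∂(μ.map X) := by
        rw [(indepFun_iff_map_prod_eq_prod_map_map hX.aemeasurable hW.aemeasurable).mp hXW,
          Measure.prod_apply hA]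
    _ ≤ ∫⁻ _, ENNReal.ofReal ε ∂(μ.map X) := by
        refine lintegral_mono fun x => ?_
        rw [Measure.map_apply hW (measurable_prodMk_left hA)]
        exact (ENNReal.le_ofReal_iff_toReal_le (measure_ne_top _ _) hε0).mpr (hε x)
    _ = ENNReal.ofReal ε := by simp

/-- Conditional Bernstein bound: the deviation of a sum `∑ j, k (Z i) (Z j)` over `j ≠ i` from
its conditional mean given `Z i`. -/
theorem measureReal_abs_sum_kernel_sub_ge_le {Ω ι : Type*} [DecidableEq ι] [MeasurableSpace Ω]
    {μ : Measure Ω} [IsProbabilityMeasure μ] {Z : ι → Ω → ℝ} (hZ : ∀ i, Measurable (Z i))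
    (hindep : iIndepFun Z μ) {k : ℝ → ℝ → ℝ} (hk : Measurable (Function.uncurry k)) {M V s : ℝ}
    (hkM : ∀ z x, k z x ∈ Set.Icc 0 M) {m : ℝ → ℝ} (hm : Measurable m)
    (hmean : ∀ i z, ∫ ω, k z (Z i ω) ∂μ = m z) (hmV : ∀ z, m z ≤ V)
    (hs0 : 0 ≤ s) (hs : s * M ≤ 1) (S : Finset ι) (i : ι) (a : ℝ) :
    μ.real {ω | a ≤ |∑ j ∈ S.erase i, (k (Z i ω) (Z j ω) - m (Z i ω))|} ≤
      2 * Real.exp ((S.erase i).card * (s ^ 2 * M * V) - s * a) := by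
  have hM : 0 ≤ M := (hkM 0 0).1.trans (hkM 0 0).2
  let W : Ω → ↥(S.erase i) → ℝ := fun ω j => Z j ω
  have hXW : IndepFun (fun ω (j : ({i} : Finset ι)) => Z j ω) W μ :=
    hindep.indepFun_finset {i} (S.erase i) (by simp) hZ
  have hXW' : IndepFun (Z i) W μ :=
    hXW.comp (φ := fun v : ↥({i} : Finset ι) → ℝ => v ⟨i, Finset.mem_singleton_self i⟩)
      (ψ := id) (measurable_pi_apply (X := fun _ => ℝ) _) measurable_id
  have hW : Measurable W := measurable_pi_lambda _ fun j => hZ j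
  let A : Set (ℝ × (↥(S.erase i) → ℝ)) :=
    {p | a ≤ |∑ j : ↥(S.erase i), (k p.1 (p.2 j) - m p.1)|}
  have hA : MeasurableSet A := by
    refine measurableSet_le measurable_const (Measurable.abs ?_)
    refine Finset.measurable_sum _ fun j _ => Measurable.sub ?_ (hm.comp measurable_fst)
    exact hk.comp (measurable_fst.prodMk ((measurable_pi_apply j).comp measurable_snd))
  have hsum : ∀ z ω, ∑ j : ↥(S.erase i), (k z (W ω j) - m z) =
      ∑ j ∈ S.erase i, (k z (Z j ω) - m z) := fun z ω =>
    Finset.sum_coe_sort (S.erase i) fun j => k z (Z j ω) - m z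
  have hfix : ∀ z, μ.real {ω | (z, W ω) ∈ A} ≤
      2 * Real.exp ((S.erase i).card * (s ^ 2 * M * V) - s * a) := by
    intro z
    have hkz : Measurable (k z) := hk.comp measurable_prodMk_left
    simp only [A, Set.mem_ofPred_eq, hsum]
    refine (measureReal_abs_sum_sub_ge_le (Y := fun j ω => k z (Z j ω)) (fun j => hkz.comp (hZ j))
      (hindep.comp (fun _ => k z) fun _ => hkz) (fun j ω => hkM z _) (fun j => hmean j z)
      hs0 hs (S.erase i) a).trans ?_
    have := hmV z
    gcongr
  have := IndepFun.measureReal_prodMk_mem_le hXW' (hZ i) hW hA hfix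
  simpa only [A, Set.mem_ofPred_eq, hsum] using this

/-- The mean of a rescaled kernel under a law with density at most `B`. -/
theorem integral_comp_sub_div_le {ν : Measure ℝ} {B : ℝ≥0} (hν : ν ≤ (B : ℝ≥0∞) • volume)
    {K : ℝ → ℝ} (hK0 : ∀ x, 0 ≤ K x) (hK : Integrable K) (c : ℝ) {r : ℝ} (hr : 0 < r) :
    ∫ x, K ((c - x) / r) ∂ν ≤ B * (r * ∫ x, K x) := by
  have hint : Integrable fun x => K ((c - x) / r) := (hK.comp_div hr.ne').comp_sub_left c
  refine (integral_mono_measure hν (.of_forall fun x => hK0 _)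
    (hint.smul_measure ENNReal.coe_ne_top)).trans_eq ?_
  rw [integral_smul_measure, integral_sub_left_eq_self (fun x => K (x / r)) volume c,
    Measure.integral_comp_div, abs_of_pos hr]
  simp

/-- The `i`-th term of an average is negligible when bounding its deviation from `m`. -/
theorem half_mul_le_abs_sum_erase {n i : ℕ} (hi : i < n) {y : ℕ → ℝ} {m M e : ℝ}
    (hy : |y i - m| ≤ M) (hM : M ≤ n * e / 2)
    (he : e < |(n : ℝ)⁻¹ * ∑ j ∈ Finset.range n, y j - m|) :
    n * e / 2 ≤ |∑ j ∈ (Finset.range n).erase i, (y j - m)| := by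
  have hn : (0 : ℝ) < n := by exact_mod_cast (Nat.zero_le i).trans_lt hi
  have hsum : (n : ℝ)⁻¹ * ∑ j ∈ Finset.range n, y j - m =
      (n : ℝ)⁻¹ * ((y i - m) + ∑ j ∈ (Finset.range n).erase i, (y j - m)) := by
    rw [Finset.add_sum_erase _ (fun j => y j - m) (Finset.mem_range.mpr hi),
      Finset.sum_sub_distrib]
    simp only [Finset.sum_const, Finset.card_range, nsmul_eq_mul]
    field_simp
  rw [hsum, abs_mul, abs_of_pos (inv_pos.mpr hn), lt_inv_mul_iff₀ hn] at he
  have := abs_add_le (y i - m) (∑ j ∈ (Finset.range n).erase i, (y j - m))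
  linarith

/-- If `u n / log n → ∞` then `u n` beats any multiple of `log n`, so that a union bound over `n`
terms of size `exp (-c * u n)` vanishes in the limit. -/
theorem tendsto_nat_mul_exp_neg_mul {u : ℕ → ℝ}
    (hu : Tendsto (fun n : ℕ => u n / Real.log n) atTop atTop) {c : ℝ} (hc : 0 < c) :
    Tendsto (fun n : ℕ => (n : ℝ) * Real.exp (-(c * u n))) atTop (𝓝 0) := by
  have hinv : Tendsto (fun n : ℕ => ((n : ℝ))⁻¹) atTop (𝓝 0) :=
    tendsto_inv_atTop_zero.comp tendsto_natCast_atTop_atTop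
  refine squeeze_zero' (.of_forall fun n => by positivity) ?_ hinv
  filter_upwards [hu.eventually_ge_atTop (2 / c), eventually_ge_atTop 2] with n hn hn2
  have hn0 : (0 : ℝ) < n := by positivity
  have hlog : 0 < Real.log n := Real.log_pos (by exact_mod_cast hn2)
  rw [div_le_div_iff₀ hc hlog] at hn
  calc (n : ℝ) * Real.exp (-(c * u n)) ≤ n * Real.exp (-Real.log n + -Real.log n) := by
        gcongr
        linarith
    _ = (n : ℝ)⁻¹ := by
        rw [Real.exp_add, Real.exp_neg, Real.exp_log hn0]
        field_simp

theorem stmt15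
    {Ω : Type*} [MeasurableSpace Ω] (μ : Measure Ω) [IsProbabilityMeasure μ]
    (Z : ℕ → Ω → ℝ) (hZmeas : ∀ i, Measurable (Z i))
    (hindep : iIndepFun Z μ)
    (hident : ∀ i, IdentDistrib (Z i) (Z 0) μ μ)
    (fZ : ℝ → ℝ)
    (hfZ : μ.map (Z 0) = (volume : Measure ℝ).withDensity
      (fun z => ENNReal.ofReal (fZ z)))
    (hfZbdd : ∃ M', ∀ z, fZ z ≤ M')
    (K1 : ℝ → ℝ) (M : ℝ) (hK1meas : Measurable K1)
    (hK1 : ∀ x, K1 x ∈ Set.Icc (0 : ℝ) M) (hK1int : Integrable K1)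
    (b : ℕ → ℝ)
    (h : ℕ → ℝ) (hhpos : ∀ n, 0 < h n)
    (hnh : Tendsto (fun n : ℕ => (n : ℝ) * h n / Real.log n) atTop atTop) :
    ∀ t : ℝ, 0 < t →
      Tendsto (fun n : ℕ =>
        (μ {ω | ∃ i < n, t * h n <
          |(n : ℝ)⁻¹ * ∑ j ∈ Finset.range n, K1 ((Z i ω - Z j ω + 2 * b n) / h n) -
            ∫ ω', K1 ((Z i ω - Z 0 ω' + 2 * b n) / h n) ∂μ|}).toReal)
        atTop (𝓝 0) := by
  intro t ht
  obtain ⟨M', hM'⟩ := hfZbdd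
  have hM0 : 0 ≤ M := (hK1 0).1.trans (hK1 0).2
  set B : ℝ≥0 := M'.toNNReal
  have hν : μ.map (Z 0) ≤ (B : ℝ≥0∞) • volume := by
    rw [hfZ, ← withDensity_const]
    exact withDensity_mono (.of_forall fun z => ENNReal.ofReal_le_ofReal (hM' z))
  set L : ℝ := B * ∫ x, K1 x
  have hL0 : 0 ≤ L := mul_nonneg B.2 (integral_nonneg fun x => (hK1 x).1)
  set k : ℕ → ℝ → ℝ → ℝ := fun n z x => K1 ((z - x + 2 * b n) / h n) with hkdef
  have hk : ∀ n, Measurable (Function.uncurry (k n)) := fun n =>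
    hK1meas.comp (by fun_prop)
  have hkM : ∀ n z x, k n z x ∈ Set.Icc 0 M := fun n z x => hK1 _
  set m : ℕ → ℝ → ℝ := fun n z => ∫ ω, k n z (Z 0 ω) ∂μ
  have hkz : ∀ n z, Measurable (k n z) := fun n z => (hk n).comp measurable_prodMk_left
  have hm : ∀ n, Measurable (m n) := fun n =>
    (StronglyMeasurable.integral_prod_right (ν := μ) (f := fun z ω => k n z (Z 0 ω))
      ((hk n).comp (measurable_fst.prodMk
        ((hZmeas 0).comp measurable_snd))).stronglyMeasurable).measurable
  have hmean : ∀ n i z, ∫ ω, k n z (Z i ω) ∂μ = m n z := fun n i z =>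
    ((hident i).comp (hkz n z)).integral_eq
  have hmM : ∀ n z, m n z ∈ Set.Icc 0 M := by
    intro n z
    refine ⟨integral_nonneg fun ω => (hkM n z _).1, ?_⟩
    have := integral_mono (μ := μ) (Integrable.of_mem_Icc 0 M
      ((hkz n z).comp (hZmeas 0)).aemeasurable (.of_forall fun ω => hkM n z _))
      (integrable_const M) fun ω => (hkM n z (Z 0 ω)).2
    simpa using this
  have hmV : ∀ n z, m n z ≤ L * h n := by
    intro n z
    have h1 : m n z = ∫ x, k n z x ∂(μ.map (Z 0)) :=
      (integral_map (hZmeas 0).aemeasurable (hkz n z).aestronglyMeasurable).symm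
    have h2 := integral_comp_sub_div_le hν (fun x => (hK1 x).1) hK1int (z + 2 * b n) (hhpos n)
    rw [h1]
    calc _ = ∫ x, K1 ((z + 2 * b n - x) / h n) ∂(μ.map (Z 0)) := by
          simp only [hkdef, add_sub_right_comm]
      _ ≤ _ := h2
      _ = L * h n := by ring
  set s : ℝ := min (1 / (M + 1)) (t / (4 * (M * L + 1)))
  have hML : 0 ≤ M * L := mul_nonneg hM0 hL0
  have hs0 : 0 < s := by positivity
  have hsM : s * M ≤ 1 := by
    have : s * (M + 1) ≤ 1 := (le_div_iff₀ (by positivity)).mp (min_le_left _ _)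
    nlinarith
  have hsV : s * (M * L) ≤ t / 4 := by
    have : s * (4 * (M * L + 1)) ≤ t := (le_div_iff₀ (by positivity)).mp (min_le_right _ _)
    nlinarith
  have hnh' : ∀ᶠ n : ℕ in atTop, M ≤ n * (t * h n) / 2 := by
    have hlog : Tendsto (fun n : ℕ => Real.log n) atTop atTop :=
      Real.tendsto_log_atTop.comp tendsto_natCast_atTop_atTop
    filter_upwards [(hnh.atTop_mul_atTop₀ hlog).eventually_ge_atTop (2 * M / t),
      hlog.eventually_gt_atTop 0] with n hn hn0
    rw [div_mul_cancel₀ _ hn0.ne', div_le_iff₀ ht] at hn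
    linarith
  have hlim := (tendsto_nat_mul_exp_neg_mul hnh (c := s * t / 4) (by positivity)).const_mul 2
  rw [mul_zero] at hlim
  refine squeeze_zero' (.of_forall fun n => ENNReal.toReal_nonneg) ?_ hlim
  filter_upwards [hnh'] with n hn
  have hdev : ∀ i, μ.real {ω | n * (t * h n) / 2 ≤
      |∑ j ∈ (Finset.range n).erase i, (k n (Z i ω) (Z j ω) - m n (Z i ω))|} ≤
      2 * Real.exp (-(s * t / 4 * (n * h n))) := by
    intro i
    refine (measureReal_abs_sum_kernel_sub_ge_le hZmeas hindep (hk n) (hkM n) (hm n) (hmean n)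
      (hmV n) hs0.le hsM (Finset.range n) i _).trans ?_
    have hcard : (((Finset.range n).erase i).card : ℝ) ≤ n := by
      exact_mod_cast (Finset.card_erase_le).trans_eq (Finset.card_range n)
    have hhn := hhpos n
    gcongr
    calc _ ≤ n * (s ^ 2 * M * (L * h n)) - s * (n * (t * h n) / 2) := by gcongr
      _ = s * (n * h n) * (s * (M * L)) - s * (n * h n) * t / 2 := by ring
      _ ≤ s * (n * h n) * (t / 4) - s * (n * h n) * t / 2 := by gcongr
      _ = _ := by ring
  calc _ ≤ μ.real (⋃ i ∈ Finset.range n, {ω | n * (t * h n) / 2 ≤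
        |∑ j ∈ (Finset.range n).erase i, (k n (Z i ω) (Z j ω) - m n (Z i ω))|}) := by
        refine measureReal_mono ?_ (measure_ne_top _ _)
        rintro ω ⟨i, hi, hω⟩
        refine Set.mem_biUnion (Finset.mem_coe.mpr (Finset.mem_range.mpr hi)) ?_
        refine half_mul_le_abs_sum_erase hi (y := fun j => k n (Z i ω) (Z j ω)) ?_ hn hω
        obtain ⟨hk0, hk1⟩ := hkM n (Z i ω) (Z i ω)
        obtain ⟨hm0, hm1⟩ := hmM n (Z i ω)
        exact abs_le.mpr ⟨by linarith, by linarith⟩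
    _ ≤ ∑ i ∈ Finset.range n, _ := measureReal_biUnion_finset_le _ _
    _ ≤ ∑ i ∈ Finset.range n, 2 * Real.exp (-(s * t / 4 * (n * h n))) :=
        Finset.sum_le_sum fun i _ => hdev i
    _ = _ := by
        simp only [Finset.sum_const, Finset.card_range, nsmul_eq_mul]
        ring

end
end
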